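/- A function f : C → ℝ on an open convex subset C ⊂ ℝ^k is C^{1,1} with derivative of Lipschitz constant ≤ B if it is both (B/2)-semiconvex and (B/2)-semiconcave (i.e., both f + (B/2)‖·‖² and −f + (B/2)‖·‖² are convex). -/

import Mathlib

open Set Filter Topology

/-- A convex function on an open convex subset of a finite-dimensional space has a subgradient at
every point. -/
theorem ConvexOn.exists_subgradient {E : Type*} [NormedAddCommGroup E] [NormedSpace ℝ E]
    [FiniteDimensional ℝ E] {C : Set E} {g : E → ℝ} (hC : IsOpen C) (hg : ConvexOn ℝ C g)
    {x : E} (hx : x ∈ C) :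
    ∃ p : E →L[ℝ] ℝ, ∀ y ∈ C, g x + p (y - x) ≤ g y := by
  have hcont : ContinuousOn g C := hg.continuousOn hC
  have hopen : IsOpen {p : E × ℝ | p.1 ∈ C ∧ g p.1 < p.2} := by
    rw [isOpen_iff_mem_nhds]
    rintro ⟨y, t⟩ ⟨hy, hyt⟩
    have hgy : ContinuousAt (fun p : E × ℝ => g p.1) (y, t) :=
      ContinuousAt.comp (f := Prod.fst) (hcont.continuousAt (hC.mem_nhds hy)) continuousAt_fst
    exact (continuousAt_fst.eventually (hC.mem_nhds hy)).and
      (hgy.eventually_lt continuousAt_snd hyt)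
  obtain ⟨L, hL⟩ := geometric_hahn_banach_open_point (x := (x, g x))
    hg.convex_strict_epigraph hopen (fun h => lt_irrefl _ h.2)
  have hsplit (y : E) (t : ℝ) : L (y, t) = L (y, 0) + t * L (0, 1) := by
    have : ((y, t) : E × ℝ) = (y, 0) + t • (0, 1) := by simp
    rw [this, map_add, map_smul, smul_eq_mul]
  have ha : L (0, 1) < 0 := by
    have h := hL (x, g x + 1) ⟨hx, lt_add_one _⟩
    rw [hsplit x, hsplit x (g x)] at h
    linarith
  refine ⟨(-(L (0, 1))⁻¹) • L.comp (ContinuousLinearMap.inl ℝ E ℝ), fun y hy => ?_⟩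
  by_contra! hlt
  have h := hL (y, _) ⟨hy, hlt⟩
  have hsub : L (y - x, 0) = L (y, 0) - L (x, 0) := by
    rw [← map_sub]; simp
  rw [hsplit y, hsplit x (g x)] at h
  simp only [smul_apply, ContinuousLinearMap.comp_apply,
    ContinuousLinearMap.inl_apply, smul_eq_mul, hsub] at h
  have hinv : (L (0, 1))⁻¹ * L (0, 1) = 1 := inv_mul_cancel₀ ha.ne
  refine h.ne ?_
  linear_combination -(L (y, 0) - L (x, 0)) * hinv

section Semiconvex

variable {E : Type*} [NormedAddCommGroup E] [InnerProductSpace ℝ E] {C : Set E} {f : E → ℝ} {B : ℝ}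

/-- A semiconvex and semiconcave function has a first-order expansion with quadratic error. -/
theorem exists_quadratic_approx_of_semiconvex_of_semiconcave [FiniteDimensional ℝ E]
    (hC : IsOpen C) (hconvex : ConvexOn ℝ C (fun x => f x + B / 2 * ‖x‖ ^ 2))
    (hconcave : ConvexOn ℝ C (fun x => -f x + B / 2 * ‖x‖ ^ 2)) {x : E} (hx : x ∈ C) :
    ∃ p : E →L[ℝ] ℝ, ∀ y ∈ C, |f y - f x - p (y - x)| ≤ B / 2 * ‖y - x‖ ^ 2 := by
  obtain ⟨p, hp⟩ := hconvex.exists_subgradient hC hx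
  obtain ⟨q, hq⟩ := hconcave.exists_subgradient hC hx
  have hmin : IsLocalMin (fun y => B * ‖y‖ ^ 2 - (p + q) y) x := by
    filter_upwards [hC.mem_nhds hx] with y hy
    have h1 := hp y hy
    have h2 := hq y hy
    simp only [map_sub, add_apply] at h1 h2 ⊢
    linarith
  have hzero := hmin.hasFDerivAt_eq_zero
    ((((hasStrictFDerivAt_norm_sq x).hasFDerivAt).const_mul B).sub (p + q).hasFDerivAt)
  have hsum (v : E) : p v + q v = 2 * B * inner ℝ x v := by
    have h := DFunLike.congr_fun hzero v
    simp at h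
    linarith
  refine ⟨p - B • innerSL ℝ x, fun y hy => ?_⟩
  have h1 := hp y hy
  have h2 := hq y hy
  have h3 := hsum (y - x)
  have h4 : ‖y‖ ^ 2 = ‖x‖ ^ 2 + 2 * inner ℝ x (y - x) + ‖y - x‖ ^ 2 := by
    rw [← norm_add_sq_real, add_sub_cancel]
  simp only [sub_apply, smul_apply, innerSL_apply_apply,
    smul_eq_mul]
  rw [h4] at h1 h2
  rw [abs_le]
  constructor <;> linarith

/-- Quadratic bounds on the first-order expansions of `f` at `x` and `y` control the difference of
the derivatives, as soon as the ball with diameter `[x, y]` lies in the domain. -/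
theorem norm_sub_le_of_quadratic_approx (hB : 0 ≤ B) {x y : E} (hxy : x ≠ y)
    {p q : E →L[ℝ] ℝ}
    (hp : ∀ z ∈ C, |f z - f x - p (z - x)| ≤ B / 2 * ‖z - x‖ ^ 2)
    (hq : ∀ z ∈ C, |f z - f y - q (z - y)| ≤ B / 2 * ‖z - y‖ ^ 2)
    (hball : Metric.closedBall (midpoint ℝ x y) (‖y - x‖ / 2) ⊆ C) :
    ‖q - p‖ ≤ B * ‖y - x‖ := by
  obtain ⟨e, he⟩ : ∃ e, e = (1 / 2 : ℝ) • (y - x) := ⟨_, rfl⟩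
  obtain ⟨m, hm⟩ : ∃ m, m = midpoint ℝ x y := ⟨_, rfl⟩
  have hmx : m = x + e := by
    rw [hm, he, midpoint_eq_smul_add, invOf_eq_inv]; module
  have hmy : m = y - e := by
    rw [hm, he, midpoint_eq_smul_add, invOf_eq_inv]; module
  have hen : ‖e‖ = ‖y - x‖ / 2 := by
    rw [he, norm_smul]; norm_num; ring
  rw [← hm, ← hen] at hball
  have key (w : E) (hw : ‖w‖ = ‖e‖) : (q - p) w ≤ 2 * B * ‖e‖ ^ 2 := by
    have h1 : m + w ∈ C := hball (by simp [hw])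
    have h2 : m - w ∈ C := hball (by simp [hw])
    have a1 := (abs_le.1 (hp _ h1)).2
    have a2 := (abs_le.1 (hp _ h2)).1
    have a3 := (abs_le.1 (hq _ h1)).1
    have a4 := (abs_le.1 (hq _ h2)).2
    have e1 : m + w - x = w + e := by rw [hmx]; abel
    have e2 : m - w - x = -(w - e) := by rw [hmx]; abel
    have e3 : m + w - y = w - e := by rw [hmy]; abel
    have e4 : m - w - y = -(w + e) := by rw [hmy]; abel
    rw [e1] at a1
    rw [e2, norm_neg] at a2
    rw [e3] at a3
    rw [e4, norm_neg] at a4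
    have hpar := parallelogram_law_with_norm ℝ w e
    rw [hw] at hpar
    have hpar' : B * (‖w + e‖ ^ 2 + ‖w - e‖ ^ 2) = B * (4 * ‖e‖ ^ 2) := by
      congr 1; linarith
    simp only [map_add, map_sub, map_neg] at a1 a2 a3 a4
    simp only [sub_apply]
    linarith
  have hpos : 0 < ‖e‖ := by
    rw [hen]
    exact half_pos (norm_pos_iff.2 (sub_ne_zero.2 hxy.symm))
  have bound (v : E) (hv : ‖v‖ ≠ 0) : (q - p) v ≤ B * ‖y - x‖ * ‖v‖ := by
    have hvpos : 0 < ‖v‖ := lt_of_le_of_ne (norm_nonneg _) (Ne.symm hv)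
    have h := key ((‖e‖ / ‖v‖) • v) (by
      rw [norm_smul, Real.norm_of_nonneg (by positivity)]; field_simp)
    rw [map_smul, smul_eq_mul, div_mul_eq_mul_div, div_le_iff₀ hvpos] at h
    have h' : ‖e‖ * (q - p) v ≤ ‖e‖ * (B * ‖y - x‖ * ‖v‖) := by
      have : ‖y - x‖ = 2 * ‖e‖ := by linarith
      rw [this]
      linarith
    exact le_of_mul_le_mul_left h' hpos
  refine ContinuousLinearMap.opNorm_le_bound' _ (by positivity) fun v hv => ?_
  rw [Real.norm_eq_abs, abs_le]
  have h := bound (-v) (by rwa [norm_neg])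
  rw [map_neg, norm_neg] at h
  exact ⟨by linarith, bound v hv⟩

end Semiconvex

/-- Subdividing a segment in an open set turns a Lipschitz estimate between pairs of points whose
ball with diameter `[x, y]` stays in the set into one between its endpoints. -/
theorem dist_le_mul_of_segment_subset {E F : Type*} [NormedAddCommGroup E] [NormedSpace ℝ E]
    [PseudoMetricSpace F] {C : Set E} (hC : IsOpen C) {g : E → F} {B : ℝ}
    (hg : ∀ x y, Metric.closedBall (midpoint ℝ x y) (‖y - x‖ / 2) ⊆ C →
      dist (g x) (g y) ≤ B * ‖y - x‖)
    {x y : E} (hxy : segment ℝ x y ⊆ C) : dist (g x) (g y) ≤ B * ‖y - x‖ := by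
  have hcomp : IsCompact (segment ℝ x y) := by
    rw [segment_eq_image_lineMap]
    exact isCompact_Icc.image AffineMap.lineMap_continuous
  obtain ⟨δ, hδ, hsub⟩ := hcomp.exists_cthickening_subset_open hC hxy
  obtain ⟨n, hn⟩ := exists_nat_gt (‖y - x‖ / 2 / δ)
  have hn0 : (0 : ℝ) < n := lt_of_le_of_lt (by positivity) hn
  have hmem (t : ℝ) (h0 : 0 ≤ t) (h1 : t ≤ 1) : AffineMap.lineMap x y t ∈ segment ℝ x y := by
    rw [segment_eq_image_lineMap]
    exact ⟨t, ⟨h0, h1⟩, rfl⟩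
  have hstep {i : ℕ} (hi : i < n) :
      dist (g (AffineMap.lineMap x y ((i : ℝ) / n)))
        (g (AffineMap.lineMap x y (((i + 1 : ℕ) : ℝ) / n))) ≤ B * (‖y - x‖ / n) := by
    have hi' : (i : ℝ) + 1 ≤ n := by exact_mod_cast hi
    have hnorm : ‖AffineMap.lineMap x y (((i + 1 : ℕ) : ℝ) / n)
        - AffineMap.lineMap x y ((i : ℝ) / n)‖ = ‖y - x‖ / n := by
      rw [← dist_eq_norm, dist_lineMap_lineMap, dist_comm x y, dist_eq_norm y x, Real.dist_eq,
        ← sub_div]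
      push_cast
      rw [add_sub_cancel_left, abs_of_pos (by positivity)]
      ring
    rw [← hnorm]
    refine hg _ _ (Subset.trans ?_ hsub)
    rw [hnorm]
    refine (Metric.closedBall_subset_closedBall ?_).trans
      (Metric.closedBall_subset_cthickening (E := segment ℝ x y) ?_ δ)
    · rw [div_lt_iff₀ hδ] at hn
      rw [div_right_comm, div_le_iff₀ hn0]
      linarith
    · refine (convex_segment x y).midpoint_mem (hmem _ (by positivity) ?_)
        (hmem _ (by positivity) ?_)
      · rw [div_le_one hn0]; linarith
      · rw [div_le_one hn0]; push_cast; exact hi'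
  have h := dist_le_range_sum_of_dist_le
    (f := fun i : ℕ => g (AffineMap.lineMap x y ((i : ℝ) / n))) n hstep
  simp only [Nat.cast_zero, zero_div, AffineMap.lineMap_apply_zero, div_self hn0.ne',
    AffineMap.lineMap_apply_one, Finset.sum_const, Finset.card_range, nsmul_eq_mul] at h
  refine h.trans_eq ?_
  field_simp

/-- A function on an open convex set that is both `(B/2)`-semiconvex and
`(B/2)`-semiconcave is C^{1,1}, with derivative of Lipschitz constant ≤ B. -/
theorem c11_of_semiconvex_and_semiconcave
    {k : ℕ} (C : Set (EuclideanSpace ℝ (Fin k))) (hC_open : IsOpen C)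
    (hC_conv : Convex ℝ C) (f : EuclideanSpace ℝ (Fin k) → ℝ) (B : ℝ) (hB : 0 ≤ B)
    (hconvex : ConvexOn ℝ C (fun x => f x + B / 2 * ‖x‖ ^ 2))
    (hconcave : ConvexOn ℝ C (fun x => -f x + B / 2 * ‖x‖ ^ 2)) :
    (∀ x ∈ C, DifferentiableAt ℝ f x) ∧
    LipschitzOnWith (Real.toNNReal B) (fun x => fderiv ℝ f x) C := by
  have main (x) (hx : x ∈ C) : DifferentiableAt ℝ f x ∧
      ∀ y ∈ C, |f y - f x - fderiv ℝ f x (y - x)| ≤ B / 2 * ‖y - x‖ ^ 2 := by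
    obtain ⟨p, hp⟩ :=
      exists_quadratic_approx_of_semiconvex_of_semiconcave hC_open hconvex hconcave hx
    have hO : (fun y => f y - f x - p (y - x)) =O[𝓝 x] fun y => ‖y - x‖ ^ 2 := by
      refine Asymptotics.IsBigO.of_bound (B / 2) ?_
      filter_upwards [hC_open.mem_nhds hx] with y hy
      simpa using hp y hy
    have hd : HasFDerivAt f p x := by
      have h0 := (hO.hasFDerivAt one_lt_two).add (p.hasFDerivAt (x := x))
      rw [zero_add] at h0
      refine (h0.add_const (f x - p x)).congr_of_eventuallyEq (.of_forall fun y => ?_)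
      simp only [Pi.add_apply, map_sub]
      ring
    exact ⟨hd.differentiableAt, by rwa [hd.fderiv]⟩
  refine ⟨fun x hx => (main x hx).1, LipschitzOnWith.of_dist_le_mul fun x hx y hy => ?_⟩
  rw [Real.coe_toNNReal _ hB, dist_comm x y, dist_eq_norm y x]
  refine dist_le_mul_of_segment_subset hC_open (g := fun x => fderiv ℝ f x)
    (fun u v huv => ?_) (hC_conv.segment_subset hx hy)
  rcases eq_or_ne u v with rfl | huv_ne
  · simp
  have hu : u ∈ C := huv (by
    rw [Metric.mem_closedBall, dist_left_midpoint, dist_eq_norm_sub', Real.norm_ofNat,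
      inv_mul_eq_div])
  have hv : v ∈ C := huv (by
    rw [Metric.mem_closedBall, dist_right_midpoint, dist_eq_norm_sub', Real.norm_ofNat,
      inv_mul_eq_div])
  rw [dist_comm, dist_eq_norm]
  exact norm_sub_le_of_quadratic_approx hB huv_ne (main u hu).2 (main v hv).2 huv
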